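/- arXiv:2506.11940 — 2 statements merged into one kernel-verified Lean document; each statement's English description precedes it below -/
import Mathlib

section
/- A pair (X*,Y*) ∈ 𝒳 × 𝒴 is a Nash equilibrium of the semidefinite game if and only if there exist real numbers w and v such that w·I_m − Φ_A(Y*) and v·I_n − Φ'_B(X*) are positive semidefinite and the matrix equations X*·(w·I_m − Φ_A(Y*)) = 0 and Y*·(v·I_n − Φ'_B(X*)) = 0 hold. -/
open Matrix BigOperators

noncomputable section

/-- Frobenius inner product of two square matrices. -/
def frob {p : ℕ} (M N : Matrix (Fin p) (Fin p) ℝ) : ℝ := ∑ i, ∑ j, M i j * N i j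

/-- Strategy space: symmetric (Hermitian) positive semidefinite matrices of trace one. -/
def Strat (p : ℕ) : Set (Matrix (Fin p) (Fin p) ℝ) :=
  {X | X.PosSemidef ∧ X.trace = 1}

/-- `Φ_A(Y)_{ij} = Σ_{k,l} A_{ijkl} Y_{kl}`. -/
def PhiA {m n : ℕ} (A : Fin m → Fin m → Fin n → Fin n → ℝ)
    (Y : Matrix (Fin n) (Fin n) ℝ) : Matrix (Fin m) (Fin m) ℝ :=
  Matrix.of fun i j => ∑ k, ∑ l, A i j k l * Y k l

/-- `Φ'_B(X)_{kl} = Σ_{i,j} X_{ij} B_{ijkl}`. -/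
def PhiB {m n : ℕ} (B : Fin m → Fin m → Fin n → Fin n → ℝ)
    (X : Matrix (Fin m) (Fin m) ℝ) : Matrix (Fin n) (Fin n) ℝ :=
  Matrix.of fun k l => ∑ i, ∑ j, X i j * B i j k l

namespace Matrix.PosSemidef

variable {ι : Type*} [Fintype ι] [DecidableEq ι] {P Q : Matrix ι ι ℝ}

/-- The trace of a product of two positive semidefinite matrices is nonnegative, and it vanishes
only if the product does. -/
theorem trace_mul_nonneg_and_mul_eq_zero (hP : P.PosSemidef) (hQ : Q.PosSemidef) :
    0 ≤ (P * Q).trace ∧ ((P * Q).trace = 0 → P * Q = 0) := by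
  obtain ⟨C, rfl⟩ : ∃ C : Matrix ι ι ℝ, P = Cᴴ * C := by
    open scoped MatrixOrder in
    exact CStarAlgebra.nonneg_iff_eq_star_mul_self.mp hP.nonneg
  obtain ⟨D, rfl⟩ : ∃ D : Matrix ι ι ℝ, Q = Dᴴ * D := by
    open scoped MatrixOrder in
    exact CStarAlgebra.nonneg_iff_eq_star_mul_self.mp hQ.nonneg
  have htr : (Cᴴ * C * (Dᴴ * D)).trace = (C * Dᴴ * (C * Dᴴ)ᴴ).trace := by
    rw [Matrix.mul_assoc, Matrix.trace_mul_comm]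
    simp [Matrix.mul_assoc]
  rw [htr]
  refine ⟨(posSemidef_self_mul_conjTranspose _).trace_nonneg, fun h => ?_⟩
  rw [trace_mul_conjTranspose_self_eq_zero_iff] at h
  rw [Matrix.mul_assoc, ← Matrix.mul_assoc C, h, Matrix.zero_mul, Matrix.mul_zero]

end Matrix.PosSemidef

section Frobenius

variable {p : ℕ}

theorem frob_comm (M N : Matrix (Fin p) (Fin p) ℝ) : frob M N = frob N M := by
  simp only [frob, mul_comm]

theorem frob_eq_trace_mul (M : Matrix (Fin p) (Fin p) ℝ) {N : Matrix (Fin p) (Fin p) ℝ}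
    (hN : N.IsSymm) : frob M N = (M * N).trace := by
  simp only [frob, Matrix.trace, Matrix.diag, Matrix.mul_apply]
  exact Finset.sum_congr rfl fun i _ => Finset.sum_congr rfl fun j _ => by rw [hN.apply]

/-- On a strategy `X`, the shifted functional `w • 1 - M` takes the value `w - ⟨X, M⟩`. -/
theorem trace_mul_smul_one_sub {X M : Matrix (Fin p) (Fin p) ℝ} (hX : X ∈ Strat p)
    (hM : M.IsSymm) (w : ℝ) :
    (X * (w • (1 : Matrix (Fin p) (Fin p) ℝ) - M)).trace = w - frob X M := by
  rw [frob_eq_trace_mul X hM, Matrix.mul_sub, Matrix.trace_sub]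
  simp [hX.2]

/-- The rank-one strategy spanned by a nonzero vector. -/
theorem inv_smul_vecMulVec_mem_strat {x : Fin p → ℝ} (hx : x ≠ 0) :
    (x ⬝ᵥ x)⁻¹ • vecMulVec x x ∈ Strat p := by
  have hpos : 0 < x ⬝ᵥ x := by simpa using dotProduct_star_self_pos_iff.mpr hx
  refine ⟨?_, ?_⟩
  · have h := posSemidef_vecMulVec_self_star x
    rw [star_trivial] at h
    exact h.smul (inv_nonneg.mpr hpos.le)
  · rw [trace_smul, trace_vecMulVec, smul_eq_mul, inv_mul_cancel₀ hpos.ne']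

/-- A strategy maximizes a linear functional on the spectrahedron of trace-one positive
semidefinite matrices if and only if it satisfies complementarity with a dual slack matrix. -/
theorem frob_maximal_iff_exists_slack {X M : Matrix (Fin p) (Fin p) ℝ} (hX : X ∈ Strat p)
    (hM : M.IsSymm) :
    (∀ X' ∈ Strat p, frob X' M ≤ frob X M) ↔
      ∃ w : ℝ, (w • (1 : Matrix (Fin p) (Fin p) ℝ) - M).PosSemidef ∧
        X * (w • (1 : Matrix (Fin p) (Fin p) ℝ) - M) = 0 := by
  constructor
  · intro hmax
    have hS : (frob X M • (1 : Matrix (Fin p) (Fin p) ℝ) - M).PosSemidef := by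
      refine PosSemidef.of_dotProduct_mulVec_nonneg ?_ fun x => ?_
      · rw [IsHermitian, conjTranspose_eq_transpose_of_trivial]
        simp [hM.eq]
      rw [star_trivial]
      by_cases hx : x = 0
      · simp [hx]
      have hpos : 0 < x ⬝ᵥ x := by simpa using dotProduct_star_self_pos_iff.mpr hx
      have h := hmax _ (inv_smul_vecMulVec_mem_strat hx)
      rw [frob_eq_trace_mul _ hM, smul_mul, trace_smul, vecMulVec_mul, trace_vecMulVec,
        smul_eq_mul, inv_mul_le_iff₀ hpos, dotProduct_comm, ← dotProduct_mulVec] at h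
      rw [sub_mulVec, dotProduct_sub, smul_mulVec, one_mulVec, dotProduct_smul, smul_eq_mul]
      linarith
    refine ⟨frob X M, hS, (hX.1.trace_mul_nonneg_and_mul_eq_zero hS).2 ?_⟩
    rw [trace_mul_smul_one_sub hX hM, sub_self]
  · rintro ⟨w, hS, hXS⟩ X' hX'
    have h := (hX'.1.trace_mul_nonneg_and_mul_eq_zero hS).1
    have h0 := trace_mul_smul_one_sub hX hM w
    rw [trace_mul_smul_one_sub hX' hM] at h
    rw [hXS, trace_zero] at h0
    linarith

end Frobenius

/-- Nash equilibria of a semidefinite game are exactly the solutions of the semidefinite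
complementarity problem in matrix-equation form. -/
theorem nash_iff_matrix_compl (m n : ℕ) (A B : Fin m → Fin m → Fin n → Fin n → ℝ)
    (hA : ∀ Y : Matrix (Fin n) (Fin n) ℝ, (PhiA A Y).IsSymm)
    (hB : ∀ X : Matrix (Fin m) (Fin m) ℝ, (PhiB B X).IsSymm)
    (X : Matrix (Fin m) (Fin m) ℝ) (Y : Matrix (Fin n) (Fin n) ℝ)
    (hX : X ∈ Strat m) (hY : Y ∈ Strat n) :
    ((∀ X' ∈ Strat m, frob X' (PhiA A Y) ≤ frob X (PhiA A Y)) ∧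
     (∀ Y' ∈ Strat n, frob (PhiB B X) Y' ≤ frob (PhiB B X) Y)) ↔
    (∃ w v : ℝ,
      (w • (1 : Matrix (Fin m) (Fin m) ℝ) - PhiA A Y).PosSemidef ∧
      (v • (1 : Matrix (Fin n) (Fin n) ℝ) - PhiB B X).PosSemidef ∧
      X * (w • (1 : Matrix (Fin m) (Fin m) ℝ) - PhiA A Y) = 0 ∧
      Y * (v • (1 : Matrix (Fin n) (Fin n) ℝ) - PhiB B X) = 0) := by
  simp only [frob_comm (PhiB B X), frob_maximal_iff_exists_slack hX (hA Y),
    frob_maximal_iff_exists_slack hY (hB X)]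
  constructor
  · rintro ⟨⟨w, hw, hXw⟩, v, hv, hYv⟩
    exact ⟨w, v, hw, hv, hXw, hYv⟩
  · rintro ⟨w, v, hw, hv, hXw, hYv⟩
    exact ⟨⟨w, hw, hXw⟩, v, hv, hYv⟩
end
end

section
/- Consider, for a parameter t > 1, the hybrid game in which player 1's strategy space is the simplex Δ_2 = {x ∈ ℝ²_{≥0} : x₁ + x₂ = 1}, player 2's strategy space is 𝒴 = {Y ∈ Sym_2(ℝ) : Y positive semidefinite, tr Y = 1}, and the payoffs are p_A(x,Y) = x₁·⟨A₁(t),Y⟩ + x₂·⟨A₂,Y⟩ and p_B(x,Y) = x₁·⟨B₁,Y⟩ + x₂·⟨B₂,Y⟩ with A₁(t) = [[t+1, t],[t, t+1]], A₂ = [[2, 1/5],[1/5, 2]], B₁ = [[2,0],[0,1]], B₂ = [[2, 1/10],[1/10, 1]]. Then the unique Nash equilibrium of this game is x = (1,0), Y = [[1,0],[0,0]]. -/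
open Matrix BigOperators

noncomputable section

/-- The bonus-perturbed payoff matrix of player 1's first pure strategy. -/
def A1t (t : ℝ) : Matrix (Fin 2) (Fin 2) ℝ := !![t + 1, t; t, t + 1]
def A2 : Matrix (Fin 2) (Fin 2) ℝ := !![2, 1/5; 1/5, 2]
def B1 : Matrix (Fin 2) (Fin 2) ℝ := !![2, 0; 0, 1]
def B2 : Matrix (Fin 2) (Fin 2) ℝ := !![2, 1/10; 1/10, 1]

/-- Payoff of player 1 in the perturbed hybrid game. -/
def pAt (t : ℝ) (x : Fin 2 → ℝ) (Y : Matrix (Fin 2) (Fin 2) ℝ) : ℝ :=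
  x 0 * frob (A1t t) Y + x 1 * frob A2 Y

/-- Payoff of player 2 in the hybrid game. -/
def pB (x : Fin 2 → ℝ) (Y : Matrix (Fin 2) (Fin 2) ℝ) : ℝ :=
  x 0 * frob B1 Y + x 1 * frob B2 Y

theorem frob_two (M N : Matrix (Fin 2) (Fin 2) ℝ) :
    frob M N = M 0 0 * N 0 0 + M 0 1 * N 0 1 + (M 1 0 * N 1 0 + M 1 1 * N 1 1) := by
  simp [frob, Fin.sum_univ_two]

/-- The entries of a two-by-two density matrix. -/
theorem entries_of_mem_strat_two {Y : Matrix (Fin 2) (Fin 2) ℝ} (hY : Y ∈ Strat 2) :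
    Y 1 0 = Y 0 1 ∧ Y 0 0 + Y 1 1 = 1 ∧ 0 ≤ Y 1 1 ∧ Y 0 1 * Y 0 1 ≤ Y 0 0 * Y 1 1 := by
  obtain ⟨hpsd, htr⟩ := hY
  have hsymm : Y 1 0 = Y 0 1 := by simpa using hpsd.isHermitian.apply 0 1
  refine ⟨hsymm, by simpa [Matrix.trace_fin_two] using htr, hpsd.diag_nonneg, ?_⟩
  have hdet := hpsd.det_nonneg
  rw [Matrix.det_fin_two, hsymm] at hdet
  linarith

theorem single_mem_strat_two : (!![1, 0; 0, 0] : Matrix (Fin 2) (Fin 2) ℝ) ∈ Strat 2 := by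
  refine ⟨?_, by simp [Matrix.trace_fin_two]⟩
  have hdiag : (!![1, 0; 0, 0] : Matrix (Fin 2) (Fin 2) ℝ) = Matrix.diagonal ![1, 0] := by
    ext i j
    fin_cases i <;> fin_cases j <;> simp
  rw [hdiag]
  refine Matrix.PosSemidef.diagonal fun i => ?_
  fin_cases i <;> simp

theorem mem_stdSimplex_two {x : Fin 2 → ℝ} :
    x ∈ stdSimplex ℝ (Fin 2) ↔ 0 ≤ x 0 ∧ 0 ≤ x 1 ∧ x 0 + x 1 = 1 := by
  simp [stdSimplex, Fin.forall_fin_two, Fin.sum_univ_two, and_assoc]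

/-- For bonus parameter `t > 1`, the unique Nash equilibrium of the perturbed hybrid game
is `x = (1,0)`, `Y = [[1,0],[0,0]]`. -/
theorem perturbed_hybrid_game_unique_equilibrium (t : ℝ) (ht : 1 < t) :
    {p : (Fin 2 → ℝ) × Matrix (Fin 2) (Fin 2) ℝ |
      p.1 ∈ stdSimplex ℝ (Fin 2) ∧ p.2 ∈ Strat 2 ∧
      (∀ x' ∈ stdSimplex ℝ (Fin 2), pAt t x' p.2 ≤ pAt t p.1 p.2) ∧
      (∀ Y' ∈ Strat 2, pB p.1 Y' ≤ pB p.1 p.2)} =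
    {((![1, 0] : Fin 2 → ℝ), (!![1, 0; 0, 0] : Matrix (Fin 2) (Fin 2) ℝ))} := by
  ext ⟨x, Y⟩
  simp only [Set.mem_ofPred_eq, Set.mem_singleton_iff, Prod.mk.injEq]
  constructor
  · rintro ⟨hx, hY, hA, hB⟩
    obtain ⟨-, hx1, hsum⟩ := mem_stdSimplex_two.1 hx
    obtain ⟨hsymm, htr, hc, hdet⟩ := entries_of_mem_strat_two hY
    have hA' := hA ![1, 0] (mem_stdSimplex_two.2 (by simp))
    have hB' := hB _ single_mem_strat_two
    have hx0 : x 0 = 1 - x 1 := by linarith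
    have ha : Y 0 0 = 1 - Y 1 1 := by linarith
    simp [pAt, frob_two, A1t, A2, hsymm, hx0, ha] at hA'
    simp [pB, frob_two, B1, B2, hsymm, hx0, ha] at hB'
    have hgain : x 1 * (t - 1 + (2 * t - 2 / 5) * Y 0 1) ≤ 0 := by linarith
    have hcorner : Y 1 1 ≤ x 1 * Y 0 1 / 5 := by linarith
    have hx1' : x 1 = 0 := by
      by_contra hne
      have hpos : 0 < x 1 := lt_of_le_of_ne hx1 (Ne.symm hne)
      have hb : 0 ≤ Y 0 1 := nonneg_of_mul_nonneg_right (by linarith) hpos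
      have hdiff : 0 < t - 1 + (2 * t - 2 / 5) * Y 0 1 :=
        add_pos_of_pos_of_nonneg (by linarith) (mul_nonneg (by linarith) hb)
      exact absurd hgain (not_le.2 (mul_pos hpos hdiff))
    have hc' : Y 1 1 = 0 := by
      rw [hx1'] at hcorner
      linarith
    have hb : Y 0 1 = 0 := by
      rw [hc', mul_zero] at hdet
      exact mul_self_eq_zero.1 (le_antisymm hdet (mul_self_nonneg _))
    constructor
    · ext i
      fin_cases i <;> simp [hx0, hx1']
    · ext i j
      fin_cases i <;> fin_cases j <;> simp [ha, hb, hc', hsymm]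
  · rintro ⟨rfl, rfl⟩
    refine ⟨mem_stdSimplex_two.2 (by simp), single_mem_strat_two, fun x' hx' => ?_,
      fun Y' hY' => ?_⟩
    · obtain ⟨-, hx1, hsum⟩ := mem_stdSimplex_two.1 hx'
      have hx0 : x' 0 = 1 - x' 1 := by linarith
      simp [pAt, frob_two, A1t, A2, hx0]
      nlinarith
    · obtain ⟨hsymm, htr, hc, -⟩ := entries_of_mem_strat_two hY'
      simp [pB, frob_two, B1]
      linarith
end
end
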